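/- For any chore division instance with additive disutilities, assuming the existence of an integral MPB allocation (X,p) that is pEF1 (as established by Mahara), there exists a 2-EFX allocation: an allocation Y such that for all agents i, h and all chores j ∈ Y_i, d_i(Y_i \ {j}) ≤ 2·d_i(Y_h). -/

import Mathlib

open Finset

/-- bundle of label `o` -/
def bun {N M : Type*} [Fintype M] [DecidableEq N] (f : M → Option N) (o : Option N) : Finset M :=
  univ.filter (fun c => f c = o)

def LowB {N M : Type*} [Fintype M] [DecidableEq N] (d : N → M → ℝ) (k : N) (v : ℝ)
    (f : M → Option N) (U : Finset N) : Prop :=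
  (∀ h, h ∉ U → v ≤ 2 * ∑ c ∈ bun f (some h), d k c) ∧ ∀ b, f b = none → v ≤ 2 * d k b

lemma mem_bun {N M : Type*} [Fintype M] [DecidableEq N] (f : M → Option N) (o : Option N) (c : M) :
    c ∈ bun f o ↔ f c = o := by simp [bun]

lemma LowB.mono {N M : Type*} [Fintype M] [DecidableEq N] {d : N → M → ℝ}
    (hd : ∀ i j, 0 < d i j) {k : N} {v : ℝ} {f f' : M → Option N} {U U' : Finset N}
    (h : LowB d k v f U)
    (h1 : ∀ h, h ∉ U' → (∃ h', h' ∉ U ∧ bun f (some h') ⊆ bun f' (some h)) ∨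
      ∃ b, f b = none ∧ f' b = some h)
    (h2 : ∀ b, f' b = none → f b = none) : LowB d k v f' U' := by
  refine ⟨fun a ha => ?_, fun b hb => h.2 b (h2 b hb)⟩
  rcases h1 a ha with ⟨h', hh', hs⟩ | ⟨b, hb, hb'⟩
  · have := h.1 h' hh'
    have := Finset.sum_le_sum_of_subset_of_nonneg (f := d k) hs (fun x _ _ => (hd k x).le)
    linarith
  · have := h.2 b hb
    have := Finset.single_le_sum (f := d k) (fun x _ => (hd k x).le)
      ((mem_bun f' (some a) b).2 hb')
    linarith

lemma LowB.le {N M : Type*} [Fintype M] [DecidableEq N] {d : N → M → ℝ}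
    {k : N} {v w : ℝ} {f : M → Option N} {U : Finset N}
    (h : LowB d k v f U) (hw : w ≤ v) : LowB d k w f U :=
  ⟨fun a ha => hw.trans (h.1 a ha), fun b hb => hw.trans (h.2 b hb)⟩

lemma sum_sdiff_le' {M : Type*} [DecidableEq M] (g : M → ℝ) (hg : ∀ j, 0 < g j)
    (s : Finset M) (c : M) : ∑ x ∈ s \ {c}, g x ≤ ∑ x ∈ s, g x :=
  Finset.sum_le_sum_of_subset_of_nonneg sdiff_subset (fun x _ _ => (hg x).le)

lemma main_ind {N M : Type*} [Fintype N] [Fintype M] [DecidableEq N] [DecidableEq M]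
    (d : N → M → ℝ) (hd : ∀ i j, 0 < d i j) (m : N → ℝ) (n : ℕ) :
    ∀ (U : Finset N) (f : M → Option N), U.card = n → (bun f none).card = n →
      (∀ k, LowB d k (2 * m k) f U) →
      (∀ i ∈ U, ∑ c ∈ bun f (some i), d i c ≤ m i) →
      (∀ i, i ∉ U → ∀ c ∈ bun f (some i),
        LowB d i (∑ c' ∈ bun f (some i) \ {c}, d i c') f U) →
      ∃ Y : N → Finset M, (∀ c : M, ∃! i, c ∈ Y i) ∧
      ∀ i h : N, ∀ c ∈ Y i, ∑ c' ∈ Y i \ {c}, d i c' ≤ 2 * ∑ c' ∈ Y h, d i c' := by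
  induction n with
  | zero =>
    intro U f hU hf hm hS hE
    rw [Finset.card_eq_zero] at hU hf
    subst hU
    refine ⟨fun i => bun f (some i), fun c => ?_, fun i h c hc => ?_⟩
    · rcases hfc : f c with _ | i
      · have := (mem_bun f none c).2 hfc
        simp [hf] at this
      · refine ⟨i, (mem_bun _ _ _).2 hfc, fun j hj => ?_⟩
        have := (mem_bun _ _ _).1 hj
        rw [hfc] at this
        exact (Option.some.inj this).symm
    · exact (hE i (by simp) c hc).1 h (by simp)
  | succ n ih =>
    intro U f hU hf hm hS hE
    obtain ⟨i, hi⟩ : U.Nonempty := by rw [← Finset.card_pos]; omega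
    obtain ⟨b, hbP, hbmin⟩ := Finset.exists_min_image (bun f none) (d i)
      (by rw [← Finset.card_pos]; omega)
    have hb := (mem_bun _ _ _).1 hbP
    have hSi := hS i hi
    by_cases hex : ∃ h, h ∉ U ∧ ∑ c ∈ bun f (some h), d i c < d i b
    · obtain ⟨h0, hh0, hlt0⟩ := hex
      obtain ⟨l, hl, hlmin⟩ := Finset.exists_min_image (Uᶜ)
        (fun h => ∑ c ∈ bun f (some h), d i c) ⟨h0, by simpa using hh0⟩
      have hlU : l ∉ U := by simpa using hl
      have hil : i ≠ l := fun e => hlU (e ▸ hi)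
      have hlow : LowB d i (2 * ∑ c ∈ bun f (some l), d i c) f U := by
        refine ⟨fun h hh => ?_, fun b' hb' => ?_⟩
        · have := hlmin h (by simpa using hh)
          linarith
        · have := hlmin h0 (by simpa using hh0)
          have := hbmin b' ((mem_bun _ _ _).2 hb')
          linarith
      set f' : M → Option N := fun c => if c = b then some l else if f c = some l then some i else f c with hf'
      have hBl : bun f' (some l) = {b} := by
        ext c; simp only [mem_bun, hf', mem_singleton]; grind
      have hBi : bun f' (some i) = bun f (some i) ∪ bun f (some l) := by
        ext c; simp only [mem_bun, hf', mem_union]; grind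
      have hBo : ∀ h, h ≠ i → h ≠ l → bun f' (some h) = bun f (some h) := by
        intro h h1 h2
        ext c; simp only [mem_bun, hf']; grind
      have hBn : bun f' none = (bun f none).erase b := by
        ext c; simp only [mem_bun, hf', mem_erase]; grind
      have hA : ∀ h, h ∉ U.erase i → (∃ h', h' ∉ U ∧ bun f (some h') ⊆ bun f' (some h)) ∨
          ∃ b, f b = none ∧ f' b = some h := by
        intro h hh
        by_cases h1 : h = i
        · subst h1
          exact Or.inl ⟨l, hlU, by rw [hBi]; exact subset_union_right⟩
        by_cases h2 : h = l
        · subst h2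
          exact Or.inr ⟨b, hb, by simp [hf']⟩
        · exact Or.inl ⟨h, fun hhU => hh (mem_erase.2 ⟨h1, hhU⟩), by rw [hBo h h1 h2]⟩
      have hN : ∀ c, f' c = none → f c = none := by
        intro c hc; simp only [hf'] at hc; grind
      refine ih (U.erase i) f' (by rw [card_erase_of_mem hi]; omega)
        (by rw [hBn, card_erase_of_mem hbP]; omega) (fun k => (hm k).mono hd hA hN) ?_ ?_
      · intro k hk
        rw [mem_erase] at hk
        rw [hBo k hk.1 (fun e => hlU (e ▸ hk.2))]
        exact hS k hk.2
      · intro k hk c hc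
        by_cases h1 : k = i
        · subst h1
          refine (hlow.mono hd hA hN).le ((sum_sdiff_le' _ (hd k) _ _).trans ?_)
          rw [hBi, sum_union]
          · have := (hm k).1 l hlU
            linarith
          · rw [Finset.disjoint_left]
            intro c h1 h2
            rw [mem_bun] at h1 h2
            rw [h1] at h2
            exact hil (Option.some.inj h2)
        by_cases h2 : k = l
        · subst h2
          rw [hBl] at hc ⊢
          rw [mem_singleton] at hc
          subst hc
          simp only [sdiff_self, bot_eq_empty, sum_empty]
          refine ⟨fun h _ => ?_, fun b' _ => ?_⟩
          · have := Finset.sum_nonneg (s := bun f' (some h)) (f := d k) (fun x _ => (hd k x).le)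
            linarith
          · have := hd k b'
            linarith
        · rw [hBo k h1 h2] at hc ⊢
          exact (hE k (fun hhU => hk (mem_erase.2 ⟨h1, hhU⟩)) c hc).mono hd hA hN
    · push Not at hex
      have hlow : LowB d i (2 * d i b) f U := by
        refine ⟨fun h hh => ?_, fun b' hb' => ?_⟩
        · have := hex h hh
          linarith
        · have := hbmin b' ((mem_bun _ _ _).2 hb')
          linarith
      set f' : M → Option N := fun c => if c = b then some i else f c with hf'
      have hBi : bun f' (some i) = insert b (bun f (some i)) := by
        ext c; simp only [mem_bun, hf', mem_insert]; grind
      have hBo : ∀ h, h ≠ i → bun f' (some h) = bun f (some h) := by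
        intro h h1
        ext c; simp only [mem_bun, hf']; grind
      have hBn : bun f' none = (bun f none).erase b := by
        ext c; simp only [mem_bun, hf', mem_erase]; grind
      have hA : ∀ h, h ∉ U.erase i → (∃ h', h' ∉ U ∧ bun f (some h') ⊆ bun f' (some h)) ∨
          ∃ b, f b = none ∧ f' b = some h := by
        intro h hh
        by_cases h1 : h = i
        · subst h1
          exact Or.inr ⟨b, hb, by simp [hf']⟩
        · exact Or.inl ⟨h, fun hhU => hh (mem_erase.2 ⟨h1, hhU⟩), by rw [hBo h h1]⟩
      have hN : ∀ c, f' c = none → f c = none := by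
        intro c hc; simp only [hf'] at hc; grind
      refine ih (U.erase i) f' (by rw [card_erase_of_mem hi]; omega)
        (by rw [hBn, card_erase_of_mem hbP]; omega) (fun k => (hm k).mono hd hA hN) ?_ ?_
      · intro k hk
        rw [mem_erase] at hk
        rw [hBo k hk.1]
        exact hS k hk.2
      · intro k hk c hc
        by_cases h1 : k = i
        · subst h1
          refine (hlow.mono hd hA hN).le ((sum_sdiff_le' _ (hd k) _ _).trans ?_)
          rw [hBi, sum_insert]
          · have := (hm k).2 b hb
            linarith
          · rw [mem_bun, hb]; simp
        · rw [hBo k h1] at hc ⊢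
          exact (hE k (fun hhU => hk (mem_erase.2 ⟨h1, hhU⟩)) c hc).mono hd hA hN

/-- Main theorem: given an integral MPB allocation that is pEF1, a 2-EFX
allocation of the chores exists. -/
theorem stmt_18 {N M : Type*} [Fintype N] [Fintype M] [DecidableEq N] [DecidableEq M]
    (d : N → M → ℝ) (hd : ∀ i j, 0 < d i j)
    (X : N → Finset M) (hpart : ∀ c : M, ∃! i, c ∈ X i) (hne : ∀ i, (X i).Nonempty)
    (p : M → ℝ) (hp : ∀ j, 0 < p j)
    (hMPB : ∀ i, ∀ j ∈ X i, ∀ c, d i j / p j ≤ d i c / p c)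
    (hpEF1 : ∀ i h : N, ∃ j ∈ X i, ∑ c ∈ X i \ {j}, p c ≤ ∑ c ∈ X h, p c) :
    ∃ Y : N → Finset M, (∀ c : M, ∃! i, c ∈ Y i) ∧
      ∀ i h : N, ∀ c ∈ Y i, ∑ c' ∈ Y i \ {c}, d i c' ≤ 2 * ∑ c' ∈ Y h, d i c' := by
  classical
  rcases isEmpty_or_nonempty N with hN | hN
  · exact ⟨X, hpart, fun i => (hN.false i).elim⟩
  obtain ⟨h0, -, hmin⟩ := Finset.exists_min_image univ (fun h => ∑ c ∈ X h, p c) univ_nonempty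
  set m := ∑ c ∈ X h0, p c with hm
  choose b hbX hbm using fun i => hpEF1 i h0
  -- MPB ratios
  have hα : ∀ i, ∃ α : ℝ, 0 < α ∧ (∀ c, α * p c ≤ d i c) ∧ ∀ c ∈ X i, d i c = α * p c := by
    intro i
    refine ⟨d i (b i) / p (b i), div_pos (hd _ _) (hp _), fun c => ?_, fun c hc => ?_⟩
    · have := hMPB i (b i) (hbX i) c
      rwa [le_div_iff₀ (hp c)] at this
    · have h1 := hMPB i (b i) (hbX i) c
      have h2 := hMPB i c hc (b i)
      have := le_antisymm h1 h2
      rw [this, div_mul_cancel₀ _ (hp c).ne']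
  choose α hα0 hαle hαeq using hα
  choose o ho hou using hpart
  have hoX : ∀ c i, c ∈ X i ↔ o c = i :=
    fun c i => ⟨fun h => (hou c i h).symm, fun h => h ▸ ho c⟩
  set H : Finset N := univ.filter (fun i => m ≤ p (b i)) with hH
  set f : M → Option N := fun c => if o c ∈ H ∧ c = b (o c) then none else some (o c) with hf
  have hob : ∀ i, o (b i) = i := fun i => (hoX _ _).1 (hbX i)
  have hBn : bun f none = H.image b := by
    ext c; simp only [mem_bun, hf, mem_image]; grind
  have hBH : ∀ i ∈ H, bun f (some i) = X i \ {b i} := by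
    intro i hi
    ext c; simp only [mem_bun, hf, mem_sdiff, mem_singleton, hoX]; grind
  have hBL : ∀ i, i ∉ H → bun f (some i) = X i := by
    intro i hi
    ext c; simp only [mem_bun, hf, hoX]; grind
  have hlow : ∀ k, LowB d k (2 * (α k * m)) f H := by
    intro k
    refine ⟨fun h hh => ?_, fun c hc => ?_⟩
    · rw [hBL h hh]
      have h1 : α k * m ≤ α k * ∑ c ∈ X h, p c :=
        mul_le_mul_of_nonneg_left (hmin h (mem_univ _)) (hα0 k).le
      have h2 : α k * ∑ c ∈ X h, p c ≤ ∑ c ∈ X h, d k c := by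
        rw [mul_sum]; exact sum_le_sum (fun c _ => hαle k c)
      linarith
    · have : c ∈ H.image b := by rw [← hBn, mem_bun]; exact hc
      obtain ⟨i, hi, rfl⟩ := mem_image.1 this
      have h1 : m ≤ p (b i) := by simpa [hH] using hi
      have h2 := mul_le_mul_of_nonneg_left h1 (hα0 k).le
      have h3 := hαle k (b i)
      linarith
  have hsum : ∀ i (s : Finset M), s ⊆ X i → ∑ c ∈ s, d i c = α i * ∑ c ∈ s, p c := by
    intro i s hs
    rw [mul_sum]
    exact sum_congr rfl (fun c hc => hαeq i c (hs hc))
  refine main_ind d hd (fun k => α k * m) H.card H f rfl ?_ hlow ?_ ?_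
  · rw [hBn, card_image_of_injective]
    intro x y hxy
    rw [← hob x, ← hob y, hxy]
  · intro i hi
    rw [hBH i hi, hsum i _ sdiff_subset]
    exact mul_le_mul_of_nonneg_left (hbm i) (hα0 i).le
  · intro i hi c hc
    rw [hBL i hi]
    refine (hlow i).le ((sum_sdiff_le' _ (hd i) _ _).trans ?_)
    rw [hsum i _ (Subset.refl _)]
    have h1 : p (b i) < m := by simpa [hH] using hi
    have h2 : ∑ c ∈ X i, p c = ∑ c ∈ X i \ {b i}, p c + p (b i) := by
      rw [← sum_sdiff (singleton_subset_iff.2 (hbX i)), sum_singleton]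
    have h3 : ∑ c ∈ X i, p c ≤ 2 * m := by
      have := hbm i
      linarith
    have := mul_le_mul_of_nonneg_left h3 (hα0 i).le
    linarith
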